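/- Let p > 0 and K > 0, and let f : ℝ → ℝ be continuously differentiable with f(0) = 0 and |f'(y)| ≤ K·(1 + |y|^p) for all y ∈ ℝ. Then there exists a constant C > 0, depending only on p and K, such that for all continuously differentiable compactly supported functions v, w, φ : ℝ² → ℝ, |∫_{ℝ²} (f(v(x)) − f(w(x)))·φ(x) dx| ≤ C · (1 + ‖v‖_{H¹}^p + ‖w‖_{H¹}^p) · ‖v − w‖_{L²(ℝ²)} · ‖φ‖_{H¹}. -/

import Mathlib

open MeasureTheory

/-- The `L²(ℝ²)`-norm of a real-valued function. -/
noncomputable def L2norm (u : EuclideanSpace ℝ (Fin 2) → ℝ) : ℝ :=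
  (eLpNorm u 2 volume).toReal

/-- The `H¹(ℝ²)`-norm `‖u‖_{L²} + ‖∇u‖_{L²}` of a real-valued function. -/
noncomputable def H1norm (u : EuclideanSpace ℝ (Fin 2) → ℝ) : ℝ :=
  (eLpNorm u 2 volume).toReal + (eLpNorm (fun x => ‖fderiv ℝ u x‖) 2 volume).toReal

open scoped ENNReal NNReal

/-- The `H¹(ℝ²)`-norm as an extended nonnegative real. -/
noncomputable def eH1norm (u : EuclideanSpace ℝ (Fin 2) → ℝ) : ℝ≥0∞ :=
  eLpNorm u 2 volume + eLpNorm (fun x => ‖fderiv ℝ u x‖) 2 volume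

theorem eH1norm_eq_ofReal_H1norm {u : EuclideanSpace ℝ (Fin 2) → ℝ} (hu : ContDiff ℝ 1 u)
    (hcu : HasCompactSupport u) : eH1norm u = ENNReal.ofReal (H1norm u) := by
  have h₀ : eLpNorm u 2 volume ≠ ∞ :=
    (hu.continuous.memLp_of_hasCompactSupport hcu).eLpNorm_ne_top
  have h₁ : eLpNorm (fun x => ‖fderiv ℝ u x‖) 2 volume ≠ ∞ :=
    ((hu.continuous_fderiv one_ne_zero).norm.memLp_of_hasCompactSupport
      (hcu.fderiv ℝ).norm).eLpNorm_ne_top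
  rw [eH1norm, H1norm, ← ENNReal.toReal_add h₀ h₁,
    ENNReal.ofReal_toReal (ENNReal.add_ne_top.2 ⟨h₀, h₁⟩)]

theorem H1norm_nonneg (u : EuclideanSpace ℝ (Fin 2) → ℝ) : 0 ≤ H1norm u :=
  add_nonneg ENNReal.toReal_nonneg ENNReal.toReal_nonneg

/-- The Cauchy–Schwarz inequality for `eLpNorm`. -/
theorem eLpNorm_one_mul_le {α : Type*} [MeasurableSpace α] {μ : Measure α} {u g : α → ℝ}
    (hu : AEStronglyMeasurable u μ) (hg : AEStronglyMeasurable g μ) :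
    eLpNorm (fun x => u x * g x) 1 μ ≤ eLpNorm u 2 μ * eLpNorm g 2 μ := by
  have h := eLpNorm_smul_le_mul_eLpNorm (r := 1) hg hu (p := 2) (q := 2)
  exact h

theorem norm_fderiv_pow_succ_mul_le {E : Type*} [NormedAddCommGroup E] [NormedSpace ℝ E]
    {v φ : E → ℝ} {x : E} (hv : DifferentiableAt ℝ v x) (hφ : DifferentiableAt ℝ φ x) (n : ℕ) :
    ‖fderiv ℝ (fun y => v y ^ (n + 1) * φ y) x‖ ≤
      (n + 1) * (|v x ^ n * φ x| * ‖fderiv ℝ v x‖) + |v x ^ n * v x| * ‖fderiv ℝ φ x‖ := by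
  have h := ((hv.hasFDerivAt.pow (n + 1)).mul hφ.hasFDerivAt).fderiv
  have h' : (fun y => v y ^ (n + 1) * φ y) = (fun y => v y ^ (n + 1)) * φ := rfl
  rw [h', h]
  refine (norm_add_le _ _).trans (le_of_eq ?_)
  simp only [norm_smul, Real.norm_eq_abs, abs_mul, abs_pow, nsmul_eq_mul,
    Nat.add_sub_cancel, Nat.abs_cast, pow_succ]
  push_cast
  ring

/-- In dimension two, `‖vⁿ φ‖_{L²} ≲ ‖v‖_{H¹}ⁿ ‖φ‖_{H¹}`. -/
theorem exists_eLpNorm_pow_mul_le (n : ℕ) : ∃ D : ℝ≥0, ∀ v φ : EuclideanSpace ℝ (Fin 2) → ℝ,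
    ContDiff ℝ 1 v → HasCompactSupport v → ContDiff ℝ 1 φ → HasCompactSupport φ →
      eLpNorm (fun x => v x ^ n * φ x) 2 volume ≤ D * eH1norm v ^ n * eH1norm φ := by
  induction n with
  | zero =>
    refine ⟨1, fun v φ _ _ _ _ => ?_⟩
    simp [eH1norm]
  | succ n ih =>
    obtain ⟨D, hD⟩ := ih
    set S : ℝ≥0 := eLpNormLESNormFDerivOneConst
      (volume : Measure (EuclideanSpace ℝ (Fin 2))) 2
    refine ⟨S * (n + 2) * D, fun v φ hv hcv hφ hcφ => ?_⟩
    have hconj : NNReal.HolderConjugate (Module.finrank ℝ (EuclideanSpace ℝ (Fin 2))) 2 := by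
      rw [finrank_euclideanSpace_fin, NNReal.holderConjugate_iff]
      norm_num
    have hsob : eLpNorm (fun x => v x ^ (n + 1) * φ x) 2 volume ≤
        S * eLpNorm (fderiv ℝ fun x => v x ^ (n + 1) * φ x) 1 volume :=
      eLpNorm_le_eLpNorm_fderiv_one volume ((hv.pow (n + 1)).mul hφ) hcφ.mul_left hconj
    have hvc := hv.continuous
    have hφc := hφ.continuous
    have hdv := (hv.continuous_fderiv one_ne_zero).norm
    have hdφ := (hφ.continuous_fderiv one_ne_zero).norm
    have hleft : eLpNorm (fun x => |v x ^ n * φ x| * ‖fderiv ℝ v x‖) 1 volume ≤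
        D * eH1norm v ^ n * eH1norm φ * eH1norm v := by
      refine (eLpNorm_one_mul_le (by fun_prop) hdv.aestronglyMeasurable).trans ?_
      refine mul_le_mul' ?_ le_add_self
      exact (eLpNorm_norm (fun x => v x ^ n * φ x)).trans_le (hD v φ hv hcv hφ hcφ)
    have hright : eLpNorm (fun x => |v x ^ n * v x| * ‖fderiv ℝ φ x‖) 1 volume ≤
        D * eH1norm v ^ n * eH1norm v * eH1norm φ := by
      refine (eLpNorm_one_mul_le (by fun_prop) hdφ.aestronglyMeasurable).trans ?_
      refine mul_le_mul' ?_ le_add_self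
      exact (eLpNorm_norm (fun x => v x ^ n * v x)).trans_le (hD v v hv hcv hv hcv)
    have hder : eLpNorm (fderiv ℝ fun x => v x ^ (n + 1) * φ x) 1 volume ≤
        (n + 1) * (D * eH1norm v ^ n * eH1norm φ * eH1norm v) +
          D * eH1norm v ^ n * eH1norm v * eH1norm φ := by
      refine (eLpNorm_mono_real fun x => norm_fderiv_pow_succ_mul_le
        (hv.differentiable one_ne_zero x) (hφ.differentiable one_ne_zero x) n).trans ?_
      refine (eLpNorm_add_le (f := fun x => ((n : ℝ) + 1) * (|v x ^ n * φ x| * ‖fderiv ℝ v x‖))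
        (g := fun x => |v x ^ n * v x| * ‖fderiv ℝ φ x‖) ?_ ?_ le_rfl).trans ?_
      · exact Continuous.aestronglyMeasurable (by fun_prop)
      · exact Continuous.aestronglyMeasurable (by fun_prop)
      refine add_le_add ?_ hright
      have hsmul := eLpNorm_const_smul_le (c := (n : ℝ) + 1) (p := 1) (μ := volume)
        (f := fun x => |v x ^ n * φ x| * ‖fderiv ℝ v x‖)
      have hc : ‖(n : ℝ) + 1‖ₑ = (n : ℝ≥0∞) + 1 := by
        rw [Real.enorm_of_nonneg (by positivity), ENNReal.ofReal_add (by positivity) zero_le_one]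
        simp
      rw [hc] at hsmul
      exact hsmul.trans (by gcongr)
    refine (hsob.trans (mul_le_mul_right hder _)).trans (le_of_eq ?_)
    push_cast
    ring

/-- In dimension two, `‖|v|^p φ‖_{L²} ≲ max(1, ‖v‖_{H¹})^p ‖φ‖_{H¹}`. -/
theorem exists_eLpNorm_rpow_mul_le {p : ℝ} (hp : 0 ≤ p) :
    ∃ D : ℝ, 0 ≤ D ∧ ∀ v φ : EuclideanSpace ℝ (Fin 2) → ℝ,
      ContDiff ℝ 1 v → HasCompactSupport v → ContDiff ℝ 1 φ → HasCompactSupport φ →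
        eLpNorm (fun x => |v x| ^ p * φ x) 2 volume ≤
          ENNReal.ofReal (D * (1 + H1norm v ^ p) * H1norm φ) := by
  obtain ⟨n, hn⟩ := exists_nat_ge p
  obtain ⟨D, hD⟩ := exists_eLpNorm_pow_mul_le n
  refine ⟨1 + D, by positivity, fun v φ hv hcv hφ hcφ => ?_⟩
  have hvc := hv.continuous
  have hφc := hφ.continuous
  have hHv := H1norm_nonneg v
  have hHφ := H1norm_nonneg φ
  set A : ℝ := max 1 (H1norm v) with hA
  have hA1 : 1 ≤ A := le_max_left _ _
  have hA0 : 0 < A := zero_lt_one.trans_le hA1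
  have hAp : A ^ p ≤ 1 + H1norm v ^ p := by
    rcases max_choice 1 (H1norm v) with h | h <;> rw [hA, h]
    · rw [Real.one_rpow]
      linarith [Real.rpow_nonneg hHv p]
    · linarith
  have hpt : ∀ x, ‖|v x| ^ p * φ x‖ ≤
      A ^ p * ‖φ x‖ + A ^ p * (A ^ n)⁻¹ * ‖v x ^ n * φ x‖ := by
    intro x
    have hscale : |v x| ^ p = A ^ p * (|v x| / A) ^ p := by
      rw [← Real.mul_rpow hA0.le (by positivity), mul_div_cancel₀ _ hA0.ne']
    have hpow : (|v x| / A) ^ p ≤ 1 + (|v x| / A) ^ n := by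
      have ht : 0 ≤ |v x| / A := by positivity
      rcases le_total (|v x| / A) 1 with h | h
      · linarith [Real.rpow_le_one ht h hp, pow_nonneg ht n]
      · have := Real.rpow_le_rpow_of_exponent_le h hn
        rw [Real.rpow_natCast] at this
        linarith
    have hApos : 0 < A ^ p := Real.rpow_pos_of_pos hA0 p
    rw [norm_mul, Real.norm_of_nonneg (Real.rpow_nonneg (abs_nonneg _) p), hscale]
    calc A ^ p * (|v x| / A) ^ p * ‖φ x‖ ≤ A ^ p * (1 + (|v x| / A) ^ n) * ‖φ x‖ := by gcongr
      _ = A ^ p * ‖φ x‖ + A ^ p * (A ^ n)⁻¹ * ‖v x ^ n * φ x‖ := by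
        simp only [norm_mul, norm_pow, Real.norm_eq_abs, div_pow]
        ring
  have hφL : eLpNorm φ 2 volume ≤ ENNReal.ofReal (H1norm φ) := by
    rw [← eH1norm_eq_ofReal_H1norm hφ hcφ]
    exact le_self_add
  have hvφL : eLpNorm (fun x => v x ^ n * φ x) 2 volume ≤
      ENNReal.ofReal (D * H1norm v ^ n * H1norm φ) := by
    refine (hD v φ hv hcv hφ hcφ).trans (le_of_eq ?_)
    rw [eH1norm_eq_ofReal_H1norm hv hcv, eH1norm_eq_ofReal_H1norm hφ hcφ,
      ENNReal.ofReal_mul (by positivity), ENNReal.ofReal_mul (by positivity),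
      ENNReal.ofReal_pow hHv, ENNReal.ofReal_coe_nnreal]
  have hconst : ∀ (c : ℝ) (g : EuclideanSpace ℝ (Fin 2) → ℝ), 0 ≤ c →
      eLpNorm (fun x => c * ‖g x‖) 2 volume ≤ ENNReal.ofReal c * eLpNorm g 2 volume := by
    intro c g hc
    rw [← Real.enorm_of_nonneg hc, ← eLpNorm_norm g]
    exact eLpNorm_const_smul_le (c := c) (f := fun x => ‖g x‖)
  refine (eLpNorm_mono_real hpt).trans ?_
  refine (eLpNorm_add_le (f := fun x => A ^ p * ‖φ x‖)
    (g := fun x => A ^ p * (A ^ n)⁻¹ * ‖v x ^ n * φ x‖) (by fun_prop) (by fun_prop)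
    one_le_two).trans ?_
  refine (add_le_add ((hconst _ _ (by positivity)).trans (mul_le_mul_right hφL _))
    ((hconst _ _ (by positivity)).trans (mul_le_mul_right hvφL _))).trans ?_
  rw [← ENNReal.ofReal_mul (by positivity), ← ENNReal.ofReal_mul (by positivity),
    ← ENNReal.ofReal_add (by positivity) (by positivity)]
  refine ENNReal.ofReal_le_ofReal ?_
  have hratio : (A ^ n)⁻¹ * H1norm v ^ n ≤ 1 := by
    rw [inv_mul_le_one₀ (by positivity)]
    exact pow_le_pow_left₀ hHv (le_max_right _ _) n
  calc A ^ p * H1norm φ + A ^ p * (A ^ n)⁻¹ * (D * H1norm v ^ n * H1norm φ)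
      = (1 + D * ((A ^ n)⁻¹ * H1norm v ^ n)) * A ^ p * H1norm φ := by ring
    _ ≤ (1 + D * 1) * (1 + H1norm v ^ p) * H1norm φ := by gcongr
    _ = (1 + D) * (1 + H1norm v ^ p) * H1norm φ := by rw [mul_one]

/-- The mean value inequality for a function whose derivative grows polynomially. -/
theorem abs_sub_le_of_abs_deriv_le_rpow {p K : ℝ} (hp : 0 ≤ p) (hK : 0 ≤ K) {f : ℝ → ℝ}
    (hf : Differentiable ℝ f) (hf' : ∀ y : ℝ, |deriv f y| ≤ K * (1 + |y| ^ p)) (a b : ℝ) :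
    |f a - f b| ≤ K * (1 + |a| ^ p + |b| ^ p) * |a - b| := by
  refine Convex.norm_image_sub_le_of_norm_deriv_le (s := Set.uIcc b a) (fun y _ => hf y)
    (fun y hy => (hf' y).trans ?_) (convex_uIcc b a) Set.left_mem_uIcc Set.right_mem_uIcc
  have ha := Real.rpow_nonneg (abs_nonneg a) p
  have hb := Real.rpow_nonneg (abs_nonneg b) p
  have hy' : |y| ≤ max |b| |a| := by
    rcases Set.mem_uIcc.1 hy with h | h
    · exact abs_le_max_abs_abs h.1 h.2
    · exact (abs_le_max_abs_abs h.1 h.2).trans_eq (max_comm _ _)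
  have hyp : |y| ^ p ≤ |a| ^ p + |b| ^ p := by
    rcases le_max_iff.1 hy' with h | h
    · linarith [Real.rpow_le_rpow (abs_nonneg y) h hp]
    · linarith [Real.rpow_le_rpow (abs_nonneg y) h hp]
  rw [add_assoc]
  gcongr

/-- Lemma 3 of the paper (the Larsson lemma), first estimate in dual form, `d = 2`:
if `f(0) = 0` and `|f'| ≤ K(1 + |·|^p)`, then
`|∫ (f∘v − f∘w)·φ| ≲ ‖v − w‖_{L²} ‖φ‖_{H¹}` with a constant depending only on `p`
and `K` (polynomially on the `H¹` norms of `v` and `w`). -/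
theorem larsson_Hminus1_estimate (p K : ℝ) (hp : 0 < p) (hK : 0 < K) :
    ∃ C : ℝ, 0 < C ∧ ∀ f : ℝ → ℝ, ContDiff ℝ 1 f → f 0 = 0 →
      (∀ y : ℝ, |deriv f y| ≤ K * (1 + |y| ^ p)) →
      ∀ v w φ : EuclideanSpace ℝ (Fin 2) → ℝ,
        ContDiff ℝ 1 v → HasCompactSupport v →
        ContDiff ℝ 1 w → HasCompactSupport w →
        ContDiff ℝ 1 φ → HasCompactSupport φ →
        |∫ x, (f (v x) - f (w x)) * φ x| ≤
          C * (1 + H1norm v ^ p + H1norm w ^ p) *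
            L2norm (fun x => v x - w x) * H1norm φ := by
  obtain ⟨D, hD0, hD⟩ := exists_eLpNorm_rpow_mul_le hp.le
  refine ⟨K * (1 + 2 * D), by positivity, fun f hf _ hf' v w φ hv hcv hw hcw hφ hcφ => ?_⟩
  have hvc := hv.continuous
  have hwc := hw.continuous
  have hφc := hφ.continuous
  have hHφ := H1norm_nonneg φ
  have hHv := Real.rpow_nonneg (H1norm_nonneg v) p
  have hHw := Real.rpow_nonneg (H1norm_nonneg w) p
  have hcont : ∀ u : EuclideanSpace ℝ (Fin 2) → ℝ, Continuous u →
      Continuous fun x => |u x| ^ p * φ x := fun u hu =>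
    (hu.abs.rpow_const fun _ => Or.inr hp.le).mul hφc
  have hcontv := hcont v hvc
  have hcontw := hcont w hwc
  have hφL : eLpNorm φ 2 volume ≤ ENNReal.ofReal (H1norm φ) := by
    rw [← eH1norm_eq_ofReal_H1norm hφ hcφ]
    exact le_self_add
  set G : EuclideanSpace ℝ (Fin 2) → ℝ :=
    (fun x => ‖φ x‖) + (fun x => ‖|v x| ^ p * φ x‖) + fun x => ‖|w x| ^ p * φ x‖ with hG
  have hGL : eLpNorm G 2 volume ≤
      ENNReal.ofReal ((1 + 2 * D) * (1 + H1norm v ^ p + H1norm w ^ p) * H1norm φ) := by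
    refine (eLpNorm_add_le (hφc.norm.add hcontv.norm).aestronglyMeasurable
      hcontw.norm.aestronglyMeasurable one_le_two).trans ?_
    refine (add_le_add_left (eLpNorm_add_le hφc.norm.aestronglyMeasurable
      hcontv.norm.aestronglyMeasurable one_le_two) _).trans ?_
    simp only [eLpNorm_norm]
    refine (add_le_add (add_le_add hφL (hD v φ hv hcv hφ hcφ)) (hD w φ hw hcw hφ hcφ)).trans ?_
    rw [← ENNReal.ofReal_add (by positivity) (by positivity),
      ← ENNReal.ofReal_add (by positivity) (by positivity)]
    refine ENNReal.ofReal_le_ofReal ?_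
    have : 0 ≤ (1 + D) * (H1norm v ^ p + H1norm w ^ p) * H1norm φ := by positivity
    linarith
  have hvw : eLpNorm (fun x => v x - w x) 2 volume =
      ENNReal.ofReal (L2norm fun x => v x - w x) :=
    (ENNReal.ofReal_toReal ((hvc.memLp_of_hasCompactSupport hcv).sub
      (hwc.memLp_of_hasCompactSupport hcw)).eLpNorm_ne_top).symm
  have hL2 : 0 ≤ L2norm fun x => v x - w x := ENNReal.toReal_nonneg
  have hpt : ∀ x, ‖(f (v x) - f (w x)) * φ x‖ ≤ K * ‖(v x - w x) * G x‖ := by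
    intro x
    have hGx : 0 ≤ G x := by
      simp only [hG, Pi.add_apply]
      positivity
    have hmv := abs_sub_le_of_abs_deriv_le_rpow hp.le hK.le (hf.differentiable one_ne_zero) hf'
      (v x) (w x)
    rw [norm_mul, norm_mul, Real.norm_of_nonneg hGx]
    refine (mul_le_mul_of_nonneg_right hmv (norm_nonneg (φ x))).trans (le_of_eq ?_)
    simp only [hG, Pi.add_apply, norm_mul, Real.norm_eq_abs,
      abs_of_nonneg (Real.rpow_nonneg (abs_nonneg _) p)]
    ring
  have hfin : ENNReal.ofReal |∫ x, (f (v x) - f (w x)) * φ x| ≤ ENNReal.ofReal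
      (K * ((L2norm fun x => v x - w x) *
        ((1 + 2 * D) * (1 + H1norm v ^ p + H1norm w ^ p) * H1norm φ))) := by
    rw [← Real.enorm_eq_ofReal_abs]
    refine (enorm_integral_le_lintegral_enorm _).trans ?_
    rw [← eLpNorm_one_eq_lintegral_enorm]
    refine (eLpNorm_le_mul_eLpNorm_of_ae_le_mul (.of_forall hpt) 1).trans ?_
    rw [ENNReal.ofReal_mul hK.le, ENNReal.ofReal_mul hL2, ← hvw]
    refine mul_le_mul_right ?_ _
    exact (eLpNorm_one_mul_le (by fun_prop)
      ((hφc.norm.add hcontv.norm).add hcontw.norm).aestronglyMeasurable).trans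
        (mul_le_mul_right hGL _)
  refine ((ENNReal.ofReal_le_ofReal_iff (by positivity)).1 hfin).trans (le_of_eq ?_)
  ring
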